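/- arXiv:1802.08559 — 2 statements merged into one kernel-verified Lean document; each statement's English description precedes it below -/
import Mathlib

section
/- Let K be a number field and let S be a finite set of finite places (nonzero prime ideals of O_K). Then the diagonal embedding of the ring of S-integers O_{K,S} into the product ∏_{v∉S} O_v of the valuation rings of the completions K_v over all finite places v not in S has dense image, where the product carries the product topology and each O_v its v-adic topology. -/
open IsDedekindDomain IsDedekindDomain.HeightOneSpectrum NumberField

open scoped WithZero in
/-- Every neighbourhood of a point of `O_v` contains a residue class of `R` modulo some power
of `v`. -/
lemma exists_forall_sub_mem_pow_imp_mem_of_mem_nhds {R : Type*} [CommRing R] [IsDedekindDomain R]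
    (K : Type*) [Field K] [Algebra R K] [IsFractionRing R K] (v : HeightOneSpectrum R)
    (x : v.adicCompletionIntegers K) {U : Set (v.adicCompletionIntegers K)} (hU : U ∈ nhds x) :
    ∃ (a : R) (n : ℕ), ∀ b : R, b - a ∈ v.asIdeal ^ n →
      algebraMap R (v.adicCompletionIntegers K) b ∈ U := by
  obtain ⟨V, hV, hVU⟩ := mem_nhds_subtype _ _ _ |>.mp hU
  obtain ⟨γ, hγ⟩ := Valued.mem_nhds.mp hV
  set g : ℤᵐ⁰ := MonoidWithZeroHom.ValueGroup₀.embedding γ.1 with hg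
  have hg0 : g ≠ 0 := by simp [hg]
  have hball : {y : v.adicCompletion K | Valued.v (y - x) < g} ∈ nhds (x : v.adicCompletion K) :=
    Valued.mem_nhds.mpr ⟨γ, fun y hy ↦ (Valuation.restrict_lt_iff_lt_embedding _).mp hy⟩
  have hint : (v.adicCompletionIntegers K : Set (v.adicCompletion K)) ∈
      nhds (x : v.adicCompletion K) :=
    (Valued.isOpen_valuationSubring _).mem_nhds x.2
  obtain ⟨_, ⟨k, rfl⟩, hk, hk1⟩ :=
    (v.denseRange_algebraMap K).inter_nhds_nonempty (Filter.inter_mem hball hint)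
  replace hk1 : v.valuation K k ≤ 1 := by
    rw [← valuedAdicCompletion_eq_valuation']
    exact hk1
  obtain ⟨a, ha⟩ := v.exists_valuation_sub_lt_of_integer hk1 (Units.mk0 g hg0)
  obtain ⟨n, hn⟩ := WithZero.exists_exp_neg_natCast_lt hg0
  refine ⟨a, n, fun b hb ↦ hVU (hγ ((Valuation.restrict_lt_iff_lt_embedding _).mpr ?_))⟩
  have hba : v.valuation K (algebraMap R K b - algebraMap R K a) < g := by
    rw [← map_sub, valuation_of_algebraMap]
    exact ((v.intValuation_le_pow_iff_mem _ n).mpr hb).trans_lt hn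
  have hbk : Valued.v (algebraMap K (v.adicCompletion K) (algebraMap R K b) -
      algebraMap K (v.adicCompletion K) k) < g := by
    rw [← map_sub]
    refine (valuedAdicCompletion_eq_valuation' v _).trans_lt ?_
    rw [← sub_add_sub_cancel _ (algebraMap R K a) k]
    exact Valuation.map_add_lt _ hba ha
  have := Valuation.map_add_lt _ hbk hk
  rwa [sub_add_sub_cancel] at this

/-- A Dedekind domain `R` is dense in any product of distinct completions `O_v`. -/
lemma denseRange_algebraMap_pi_adicCompletionIntegers {R : Type*} [CommRing R]
    [IsDedekindDomain R] (K : Type*) [Field K] [Algebra R K] [IsFractionRing R K]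
    (T : Set (HeightOneSpectrum R)) :
    DenseRange (fun (r : R) (v : T) ↦ algebraMap R (v.1.adicCompletionIntegers K) r) := by
  intro x
  rw [mem_closure_iff_nhds]
  intro U hU
  rw [nhds_pi, Filter.mem_pi'] at hU
  obtain ⟨I, t, ht, htU⟩ := hU
  choose a n h using fun v : T ↦
    exists_forall_sub_mem_pow_imp_mem_of_mem_nhds K v.1 (x v) (ht v)
  obtain ⟨r, hr⟩ := IsDedekindDomain.exists_forall_sub_mem_ideal (s := I)
    (fun v ↦ v.1.asIdeal) n (fun v _ ↦ v.1.prime)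
    (fun v _ w _ hvw h ↦ hvw (Subtype.ext (HeightOneSpectrum.ext h))) (fun v ↦ a v)
  exact ⟨_, htU fun v hv ↦ h v r (hr v hv), r, rfl⟩

/-- For a number field `K` and a finite set `S` of finite places, the
diagonal embedding of the ring of `S`-integers into the product `∏_{v ∉ S} O_v` of the
valuation rings of the completions at all finite places outside `S` has dense image. -/
theorem denseRange_sInteger_diagonal_embedding
    (K : Type*) [Field K] [NumberField K]
    (S : Set (HeightOneSpectrum (𝓞 K))) (hS : S.Finite) :
    DenseRange (fun (x : S.integer K) (v : {v : HeightOneSpectrum (𝓞 K) // v ∉ S}) =>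
      (⟨((x : K) : v.1.adicCompletion K), by
          rw [mem_adicCompletionIntegers, valuedAdicCompletion_eq_valuation']
          exact Set.integer_valuation_le_one S K x v.2⟩ :
        v.1.adicCompletionIntegers K)) := by
  refine (denseRange_algebraMap_pi_adicCompletionIntegers K Sᶜ).mono ?_
  rintro _ ⟨r, rfl⟩
  exact ⟨algebraMap (𝓞 K) (S.integer K) r, rfl⟩
end

section
/- Let K be a number field, let n ≥ 2, and let S₁ ⊆ S₂ be finite sets of finite places of K with S₁ ≠ S₂. Then the subgroup SL_n(O_{K,S₁}) has infinite index in SL_n(O_{K,S₂}). -/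
open IsDedekindDomain NumberField

/-- Monotonicity of `S`-integers: enlarging the set of places enlarges the ring of
`S`-integers. -/
theorem Set.integer_mono {R : Type*} [CommRing R] [IsDedekindDomain R]
    {S₁ S₂ : Set (HeightOneSpectrum R)} (h : S₁ ⊆ S₂) (K : Type*) [Field K] [Algebra R K]
    [IsFractionRing R K] : S₁.integer K ≤ S₂.integer K :=
  fun _ hx v hv => hx v fun h1 => hv (h h1)

/-- For every nonzero prime `v` of a Dedekind domain there is an element of the fraction field
whose only pole is at `v`. -/
theorem exists_one_lt_valuation_and_forall_ne_le_one {R : Type*} [CommRing R] [IsDedekindDomain R]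
    (K : Type*) [Field K] [Algebra R K] [IsFractionRing R K] (v : HeightOneSpectrum R) :
    ∃ x : K, 1 < v.valuation K x ∧
      ∀ w : HeightOneSpectrum R, w ≠ v → w.valuation K x ≤ 1 := by
  obtain ⟨x, hx, hx1⟩ :=
    FractionalIdeal.exists_notMem_one_of_ne_bot (K := K) v.ne_bot v.isPrime.ne_top
  rw [FractionalIdeal.mem_inv_iff (FractionalIdeal.coeIdeal_ne_zero.mpr v.ne_bot)] at hx
  have hw : ∀ w : HeightOneSpectrum R, w ≠ v → w.valuation K x ≤ 1 := by
    intro w hwv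
    have hnle : ¬ v.asIdeal ≤ w.asIdeal := fun hle =>
      hwv (HeightOneSpectrum.ext
        ((v.isMaximal.eq_of_le w.isPrime.ne_top hle).symm))
    obtain ⟨c, hcv, hcw⟩ := Set.not_subset.mp hnle
    obtain ⟨y, hy⟩ := (FractionalIdeal.mem_one_iff _).mp
      (hx (algebraMap R K c) (FractionalIdeal.mem_coeIdeal_of_mem _ hcv))
    have hc : w.valuation K (algebraMap R K c) = 1 :=
      w.valuation_eq_one_iff_notMem.mpr hcw
    have hle : w.valuation K (algebraMap R K y) ≤ 1 := w.valuation_le_one y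
    rwa [hy, map_mul, hc, mul_one] at hle
  refine ⟨x, ?_, hw⟩
  by_contra! hv
  obtain ⟨y, hy⟩ := HeightOneSpectrum.mem_integers_of_valuation_le_one K x fun w => by
    by_cases h : w = v
    · exact h ▸ hv
    · exact hw w h
  exact hx1 ((FractionalIdeal.mem_one_iff _).mpr ⟨y, hy⟩)

/-- If distinct powers of an element `x` are pairwise incongruent modulo the image of a ring
homomorphism `f : A →+* B`, then `SL_n(A)` has image of infinite index in `SL_n(B)`. -/
theorem Matrix.SpecialLinearGroup.index_range_map_eq_zero {A B ι : Type*} [CommRing A] [CommRing B]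
    [Fintype ι] [DecidableEq ι] [Nontrivial ι] (f : A →+* B) (x : B)
    (hx : ∀ k l : ℕ, k < l → x ^ k - x ^ l ∉ f.range) :
    (Matrix.SpecialLinearGroup.map (n := ι) f).range.index = 0 := by
  obtain ⟨i, j, hij⟩ := exists_pair_ne ι
  by_contra hindex
  have : (Matrix.SpecialLinearGroup.map (n := ι) f).range.FiniteIndex := ⟨hindex⟩
  refine not_injective_infinite_finite
    (fun k : ℕ => (QuotientGroup.mk (transvection hij (x ^ k)) :
      SpecialLinearGroup ι B ⧸ (Matrix.SpecialLinearGroup.map (n := ι) f).range)) ?_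
  intro k l heq
  by_contra hne
  wlog hkl : k < l generalizing k l
  · exact this heq.symm (Ne.symm hne) (lt_of_le_of_ne (not_lt.mp hkl) (Ne.symm hne))
  refine hx k l hkl ?_
  obtain ⟨M, hM⟩ := QuotientGroup.eq.mp heq.symm
  rw [transvection_inv, ← transvection_add] at hM
  refine ⟨M i j, ?_⟩
  have hentry := congrArg (fun N : SpecialLinearGroup ι B => N i j) hM
  simpa [transvection_coe, hij, sub_eq_neg_add] using hentry

/-- For `n ≥ 2` and finite sets of finite places `S₁ ⊆ S₂` of a number
field `K` with `S₁ ≠ S₂`, the subgroup `SL_n(O_{K,S₁})` (embedded via the inclusion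
`O_{K,S₁} ⊆ O_{K,S₂}`) has infinite index in `SL_n(O_{K,S₂})`. -/
theorem sl_n_sInteger_infinite_index
    (K : Type*) [Field K] [NumberField K] (n : ℕ) (hn : 2 ≤ n)
    (S₁ S₂ : Set (HeightOneSpectrum (𝓞 K))) (h₁ : S₁.Finite) (h₂ : S₂.Finite)
    (hsub : S₁ ⊆ S₂) (hne : S₁ ≠ S₂) :
    (Matrix.SpecialLinearGroup.map (n := Fin n)
      (Subalgebra.inclusion (Set.integer_mono hsub K)).toRingHom).range.index = 0 := by
  obtain ⟨v, hv₂, hv₁⟩ := Set.exists_of_ssubset (hsub.ssubset_of_ne hne)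
  obtain ⟨x, hxv, hxw⟩ := exists_one_lt_valuation_and_forall_ne_le_one K v
  have : Nontrivial (Fin n) := Fin.nontrivial_iff_two_le.mpr hn
  refine Matrix.SpecialLinearGroup.index_range_map_eq_zero _
    (⟨x, fun w hw => hxw w fun h => hw (h ▸ hv₂)⟩ : S₂.integer K) ?_
  rintro k l hkl ⟨y, hy⟩
  have hy' : (y : K) = x ^ k - x ^ l := congrArg Subtype.val hy
  have hle : v.valuation K (x ^ k - x ^ l) ≤ 1 := hy' ▸ y.property v hv₁
  rw [Valuation.map_sub_eq_of_lt_right _ (by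
    simpa only [map_pow] using pow_lt_pow_right₀ hxv hkl), map_pow] at hle
  exact hle.not_gt (one_lt_pow₀ hxv (Nat.ne_zero_of_lt hkl))
end
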